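/- Let F be a nontrivial finite group and H a finitely generated infinite group of super-linear growth. Then for every k ≥ 1, every asymptotic cone of F ≀ H (with respect to any ultrafilter, basepoints and scaling sequence) contains a biLipschitz embedded copy of the cube [0,1]^k. Consequently the asymptotic cones of F ≀ H have infinite topological dimension. -/

import Mathlib

/-- The direct sum `⊕_H F`, realised as the subgroup of `H → F` of finitely
supported functions. -/
def lampN (F H : Type*) [Group F] [Group H] : Subgroup (H → F) where
  carrier := {f | {h | f h ≠ 1}.Finite}
  one_mem' := Set.Finite.subset Set.finite_empty (by intro h hh; exact (hh rfl).elim)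
  mul_mem' := by
    intro a b ha hb
    refine Set.Finite.subset (Set.Finite.union ha hb) ?_
    intro h hh
    by_contra hc
    simp only [Set.mem_union, Set.mem_setOf_eq, not_or, not_not] at hc
    exact hh (by simp [hc.1, hc.2])
  inv_mem' := by
    intro a ha
    refine Set.Finite.subset ha ?_
    intro h hh
    simp only [Set.mem_setOf_eq, Pi.inv_apply, ne_eq, inv_eq_one] at hh
    exact hh

/-- The shift of a finitely supported function by `a : H`. -/
def shiftAux {F H : Type*} [Group F] [Group H] (a : H) (f : ↥(lampN F H)) :
    ↥(lampN F H) :=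
  ⟨fun h => (f : H → F) (a⁻¹ * h), by
    have hf : {h : H | (f : H → F) h ≠ 1}.Finite := f.2
    show {h : H | (f : H → F) (a⁻¹ * h) ≠ 1}.Finite
    have : {h : H | (f : H → F) (a⁻¹ * h) ≠ 1} =
        (fun h : H => a⁻¹ * h) ⁻¹' {h : H | (f : H → F) h ≠ 1} := rfl
    rw [this]
    exact Set.Finite.preimage ((mul_right_injective a⁻¹).injOn) hf⟩

/-- The shift automorphism of `⊕_H F` given by `a : H`. -/
def lampShift {F H : Type*} [Group F] [Group H] (a : H) :
    ↥(lampN F H) ≃* ↥(lampN F H) where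
  toFun := shiftAux a
  invFun := shiftAux a⁻¹
  left_inv := by
    intro f; apply Subtype.ext; funext h
    show (f : H → F) (a⁻¹ * ((a⁻¹)⁻¹ * h)) = (f : H → F) h
    rw [inv_inv, inv_mul_cancel_left]
  right_inv := by
    intro f; apply Subtype.ext; funext h
    show (f : H → F) ((a⁻¹)⁻¹ * (a⁻¹ * h)) = (f : H → F) h
    rw [inv_inv, mul_inv_cancel_left]
  map_mul' := by
    intro f g; apply Subtype.ext; funext h; rfl

/-- The action of `H` on `⊕_H F` by permuting the coordinates. -/
def lampAct (F H : Type*) [Group F] [Group H] : H →* MulAut ↥(lampN F H) where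
  toFun a := lampShift (F := F) a
  map_one' := MulEquiv.ext fun f => Subtype.ext (funext fun h => by
    show (f : H → F) ((1 : H)⁻¹ * h) = (f : H → F) h
    rw [inv_one, one_mul])
  map_mul' a b := MulEquiv.ext fun f => Subtype.ext (funext fun h => by
    show (f : H → F) ((a * b)⁻¹ * h) = (f : H → F) (b⁻¹ * (a⁻¹ * h))
    rw [mul_inv_rev, mul_assoc])

/-- The (restricted) wreath product `F ≀ H = (⊕_H F) ⋊ H`. -/
abbrev Wr (F H : Type*) [Group F] [Group H] :=
  SemidirectProduct ↥(lampN F H) H (lampAct F H)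

/-- The canonical copy of `H` inside the wreath product `F ≀ H`. -/
def Hsub (F H : Type*) [Group F] [Group H] : Subgroup (Wr F H) :=
  (SemidirectProduct.inr : H →* Wr F H).range

/-- The word length of `g` with respect to the symmetrised generating set `S`. -/
noncomputable def wlen {A : Type*} [Group A] (S : Set A) (g : A) : ℕ :=
  sInf {k | ∃ l : List A, l.length = k ∧ (∀ x ∈ l, x ∈ S ∨ x⁻¹ ∈ S) ∧ l.prod = g}

/-- The word metric on a group with respect to a generating set `S`. -/
noncomputable def wdist {A : Type*} [Group A] (S : Set A) (g h : A) : ℕ :=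
  wlen S (g⁻¹ * h)

section WordLength

variable {A : Type*} [Group A] {S : Set A}

theorem wlen_le_of_list {g : A} (l : List A) (h : ∀ x ∈ l, x ∈ S ∨ x⁻¹ ∈ S) (hp : l.prod = g) :
    wlen S g ≤ l.length := Nat.sInf_le ⟨l, rfl, h, hp⟩

theorem wlen_spec (hS : Subgroup.closure S = ⊤) (g : A) :
    ∃ l : List A, l.length = wlen S g ∧ (∀ x ∈ l, x ∈ S ∨ x⁻¹ ∈ S) ∧ l.prod = g := by
  have hg : g ∈ Subgroup.closure S := by rw [hS]; trivial
  rw [← Subgroup.mem_toSubmonoid, Subgroup.closure_toSubmonoid] at hg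
  obtain ⟨l, h1, h2⟩ := Submonoid.exists_list_of_mem_closure hg
  exact Nat.sInf_mem (s := {k | ∃ l : List A, l.length = k ∧ (∀ x ∈ l, x ∈ S ∨ x⁻¹ ∈ S) ∧
    l.prod = g}) ⟨_, l, rfl, h1, h2⟩

theorem wlen_one : wlen S (1 : A) = 0 := by
  have := wlen_le_of_list (S := S) (g := 1) [] (by simp) (by simp)
  simpa using this

theorem wlen_mul (hS : Subgroup.closure S = ⊤) (g h : A) :
    wlen S (g * h) ≤ wlen S g + wlen S h := by
  obtain ⟨l, h1, h2, h3⟩ := wlen_spec hS g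
  obtain ⟨l', h1', h2', h3'⟩ := wlen_spec hS h
  rw [← h1, ← h1', ← List.length_append]
  apply wlen_le_of_list
  · intro x hx
    rcases List.mem_append.1 hx with hx | hx
    · exact h2 x hx
    · exact h2' x hx
  · rw [List.prod_append, h3, h3']

theorem wlen_inv_le (hS : Subgroup.closure S = ⊤) (g : A) : wlen S g⁻¹ ≤ wlen S g := by
  obtain ⟨l, h1, h2, h3⟩ := wlen_spec hS g
  have := wlen_le_of_list (S := S) (g := g⁻¹) (l.map (·⁻¹)).reverse (by
    intro x hx
    simp only [List.mem_reverse, List.mem_map] at hx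
    obtain ⟨y, hy, rfl⟩ := hx
    rw [inv_inv]
    exact (h2 y hy).symm) (by rw [← h3, List.prod_inv_reverse])
  simpa [h1] using this

theorem wlen_inv (hS : Subgroup.closure S = ⊤) (g : A) : wlen S g⁻¹ = wlen S g := by
  apply le_antisymm (wlen_inv_le hS g)
  have := wlen_inv_le hS g⁻¹
  rwa [inv_inv] at this

theorem wlen_eq_zero (hS : Subgroup.closure S = ⊤) {g : A} (h : wlen S g = 0) : g = 1 := by
  obtain ⟨l, h1, h2, h3⟩ := wlen_spec hS g
  rw [h, List.length_eq_zero_iff] at h1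
  rw [← h3, h1, List.prod_nil]

theorem wlen_ball_one_finite (T : Finset A) (hS : Subgroup.closure (T : Set A) = ⊤) :
    {g : A | wlen (T : Set A) g ≤ 1}.Finite := by
  apply Set.Finite.subset (((Set.finite_singleton (1 : A)).union T.finite_toSet).union
    T.finite_toSet.inv)
  intro g hg
  obtain ⟨l, h1, h2, h3⟩ := wlen_spec hS g
  rw [Set.mem_ofPred_eq, ← h1] at hg
  match l, h1, h2, h3, hg with
  | [], _, _, h3, _ => left; left; simpa using h3.symm
  | [x], _, h2, h3, _ =>
    have h3' : x = g := by simpa using h3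
    have := h2 x (by simp)
    rw [h3'] at this
    rcases this with h | h
    · left; right; exact h
    · right; exact h
  | _ :: _ :: _, _, _, _, hg => simp at hg

theorem exists_parent (hS : Subgroup.closure S = ⊤) (g : A) :
    ∃ v, wlen S v = wlen S g - 1 ∧ wlen S (v⁻¹ * g) ≤ 1 := by
  obtain ⟨l, h1, h2, h3⟩ := wlen_spec hS g
  rcases List.eq_nil_or_concat l with rfl | ⟨l', t, rfl⟩
  · have : g = 1 := by simpa using h3.symm
    subst this
    exact ⟨1, by simp [wlen_one], by simp [wlen_one]⟩
  · have ha : wlen S l'.prod ≤ l'.length :=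
      wlen_le_of_list l' (fun x hx => h2 x (by simp [hx])) rfl
    have hb : wlen S t ≤ 1 := by
      have := wlen_le_of_list (S := S) (g := t) [t] (by
        intro x hx
        exact h2 x (by simp at hx; simp [hx])) (by simp)
      simpa using this
    have hg : g = l'.prod * t := by rw [← h3]; simp
    have hc := wlen_mul hS l'.prod t
    rw [← hg] at hc
    refine ⟨l'.prod, ?_, ?_⟩
    · simp at h1; omega
    · rw [hg, inv_mul_cancel_left]; exact hb

theorem wlen_bilip {B : Type*} [Group B] (hS : Subgroup.closure S = ⊤) {S' : Set B}
    (hS' : Subgroup.closure S' = ⊤) (φ : A →* B) (K : ℕ) (hK : ∀ t ∈ S, wlen S' (φ t) ≤ K)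
    (g : A) : wlen S' (φ g) ≤ K * wlen S g := by
  obtain ⟨l, h1, h2, h3⟩ := wlen_spec hS g
  rw [← h1, ← h3]
  clear h1 h3
  induction l with
  | nil => simp [wlen_one]
  | cons x l ih =>
    have h4 := ih (fun y hy => h2 y (by simp [hy]))
    have h5 : wlen S' (φ x) ≤ K := by
      rcases h2 x (by simp) with h | h
      · exact hK _ h
      · have := hK _ h
        rwa [map_inv, wlen_inv hS'] at this
    rw [List.prod_cons, map_mul, List.length_cons]
    have := wlen_mul hS' (φ x) (φ l.prod)
    rw [mul_add]
    omega

end WordLength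

section Tour

variable {H : Type*} [Group H] {T : Set H}

/-- A set `D` that can be enumerated by steps of length at most `3`, starting at `v` and ending
at distance at most one from `v`. -/
def GoodTour (T : Set H) (D : Set H) (v : H) : Prop :=
  ∃ l : List H, l.Nodup ∧ l.IsChain (fun a b => wlen T (a⁻¹ * b) ≤ 3) ∧ l.head? = some v ∧
    (∃ w, l.getLast? = some w ∧ wlen T (v⁻¹ * w) ≤ 1) ∧ ∀ x, x ∈ l ↔ x ∈ D

theorem goodTour_single (v : H) : GoodTour T {v} v :=
  ⟨[v], by simp, by simp, by simp, ⟨v, by simp, by simp [wlen_one]⟩, by simp⟩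

theorem goodTour_merge (hT : Subgroup.closure T = ⊤) {D E : Set H} {v c : H}
    (hD : GoodTour T D v) (hE : GoodTour T E c) (hd : Disjoint D E)
    (hvc : wlen T (v⁻¹ * c) ≤ 1) : GoodTour T (D ∪ E) v := by
  obtain ⟨l, n1, c1, h1, ⟨w, w1, w2⟩, m1⟩ := hD
  obtain ⟨l', n1', c1', h1', ⟨w', w1', w2'⟩, m1'⟩ := hE
  refine ⟨l ++ l'.reverse, ?_, ?_, ?_, ⟨c, ?_, hvc⟩, ?_⟩
  · rw [List.nodup_append]
    refine ⟨n1, List.nodup_reverse.2 n1', ?_⟩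
    intro a ha b hb hab
    subst hab
    exact Set.disjoint_left.1 hd ((m1 _).1 ha) ((m1' _).1 (by simpa using hb))
  · rw [List.isChain_append]
    refine ⟨c1, ?_, ?_⟩
    · rw [List.isChain_reverse]
      refine c1'.imp ?_
      intro a b hab
      have := wlen_inv hT (a⁻¹ * b)
      rw [mul_inv_rev, inv_inv] at this
      show wlen T (b⁻¹ * a) ≤ 3
      rw [this]
      exact hab
    · intro x hx y hy
      rw [w1] at hx
      rw [List.head?_reverse, w1'] at hy
      simp only [Option.mem_def, Option.some.injEq] at hx hy
      subst hx hy
      have e : w⁻¹ * w' = (v⁻¹ * w)⁻¹ * (v⁻¹ * c) * (c⁻¹ * w') := by group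
      rw [e]
      have a1 := wlen_mul hT ((v⁻¹ * w)⁻¹ * (v⁻¹ * c)) (c⁻¹ * w')
      have a2 := wlen_mul hT ((v⁻¹ * w)⁻¹) (v⁻¹ * c)
      rw [wlen_inv hT] at a2
      omega
  · rw [List.head?_append, h1]; rfl
  · rw [List.getLast?_append, List.getLast?_reverse, h1']; rfl
  · intro x
    simp [m1, m1']

theorem goodTour_biUnion (hT : Subgroup.closure T = ⊤) {D : Set H} {v : H} (hD : GoodTour T D v)
    (E : H → Set H) (C : Finset H) (hE : ∀ c ∈ C, GoodTour T (E c) c)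
    (hC : ∀ c ∈ C, wlen T (v⁻¹ * c) ≤ 1) (hDE : ∀ c ∈ C, Disjoint D (E c))
    (hEE : ∀ c ∈ C, ∀ c' ∈ C, c ≠ c' → Disjoint (E c) (E c')) :
    GoodTour T (D ∪ ⋃ c ∈ C, E c) v := by
  classical
  induction C using Finset.induction_on with
  | empty => simpa using hD
  | insert c C hc ih =>
    have h1 := ih (fun x hx => hE x (by simp [hx])) (fun x hx => hC x (by simp [hx]))
      (fun x hx => hDE x (by simp [hx])) (fun x hx y hy => hEE x (by simp [hx]) y (by simp [hy]))
    have h2 := goodTour_merge hT h1 (hE c (by simp)) (by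
      rw [Set.disjoint_union_left]
      refine ⟨hDE c (by simp), ?_⟩
      simp only [Set.disjoint_iUnion_left]
      intro x hx
      exact hEE x (by simp [hx]) c (by simp) (by rintro rfl; exact hc hx)) (hC c (by simp))
    convert h2 using 1
    rw [Finset.set_biUnion_insert, Set.union_assoc, Set.union_comm (E c)]

theorem goodTour_tree (T : Finset H) (hT : Subgroup.closure (T : Set H) = ⊤) (p : H → H)
    (hp : ∀ g, wlen (T : Set H) (p g) = wlen (T : Set H) g - 1)
    (hp' : ∀ g, wlen (T : Set H) ((p g)⁻¹ * g) ≤ 1) (n : ℕ) : ∀ v : H,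
    GoodTour (T : Set H) {x | wlen (T : Set H) v ≤ wlen (T : Set H) x ∧
      wlen (T : Set H) x ≤ wlen (T : Set H) v + n ∧
      p^[wlen (T : Set H) x - wlen (T : Set H) v] x = v} v := by
  induction n with
  | zero =>
    intro v
    convert goodTour_single (T := (T : Set H)) v using 1
    ext x
    simp only [Set.mem_ofPred_eq, Set.mem_singleton_iff]
    constructor
    · rintro ⟨h1, h2, h3⟩
      have : wlen (T : Set H) x - wlen (T : Set H) v = 0 := by omega
      rw [this] at h3
      exact h3
    · rintro rfl
      simp
  | succ n ih =>
    intro v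
    have hfin : {c : H | wlen (T : Set H) c = wlen (T : Set H) v + 1 ∧ p c = v}.Finite := by
      apply Set.Finite.subset ((wlen_ball_one_finite T hT).image (fun t => v * t))
      rintro c ⟨_, hc⟩
      refine ⟨v⁻¹ * c, ?_, by simp⟩
      rw [← hc]; exact hp' c
    have key := goodTour_biUnion hT (goodTour_single (T := (T : Set H)) v)
      (fun c => {x | wlen (T : Set H) c ≤ wlen (T : Set H) x ∧
      wlen (T : Set H) x ≤ wlen (T : Set H) c + n ∧
      p^[wlen (T : Set H) x - wlen (T : Set H) c] x = c}) hfin.toFinset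
      (fun c _ => ih c) ?_ ?_ ?_
    · convert key using 1
      ext x
      simp only [Set.mem_ofPred_eq, Set.singleton_union, Set.Finite.mem_toFinset, Set.mem_insert_iff,
        Set.mem_iUnion, exists_prop]
      constructor
      · rintro ⟨h1, h2, h3⟩
        by_cases h : wlen (T : Set H) x = wlen (T : Set H) v
        · left
          rw [h] at h3
          simpa using h3
        · right
          have e : wlen (T : Set H) x - wlen (T : Set H) v =
            (wlen (T : Set H) x - (wlen (T : Set H) v + 1)) + 1 := by omega
          have hlev : ∀ j, wlen (T : Set H) (p^[j] x) = wlen (T : Set H) x - j := by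
            intro j
            induction j with
            | zero => simp
            | succ j ihj => rw [Function.iterate_succ_apply', hp, ihj]; omega
          rw [e, Function.iterate_succ_apply'] at h3
          have e2 := hlev (wlen (T : Set H) x - (wlen (T : Set H) v + 1))
          have e3 : wlen (T : Set H) (p^[wlen (T : Set H) x - (wlen (T : Set H) v + 1)] x) =
            wlen (T : Set H) v + 1 := by omega
          refine ⟨_, ⟨e3, h3⟩, ?_, ?_, ?_⟩
          · omega
          · omega
          · rw [e3]
      · rintro (rfl | ⟨c, ⟨h1, h2⟩, h3, h4, h5⟩)
        · simp
        · refine ⟨by omega, by omega, ?_⟩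
          have e : wlen (T : Set H) x - wlen (T : Set H) v =
            (wlen (T : Set H) x - wlen (T : Set H) c) + 1 := by omega
          rw [e, Function.iterate_succ_apply', h5, h2]
    · intro c hc
      rw [Set.Finite.mem_toFinset] at hc
      rw [← hc.2]; exact hp' c
    · intro c hc
      rw [Set.Finite.mem_toFinset] at hc
      rw [Set.disjoint_singleton_left]
      rintro ⟨h1, -⟩
      have := hc.1
      omega
    · intro c hc c' hc' hne
      rw [Set.Finite.mem_toFinset] at hc hc'
      rw [Set.disjoint_left]
      rintro x ⟨_, _, h3⟩ ⟨_, _, h4⟩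
      rw [hc.1] at h3
      rw [hc'.1] at h4
      exact hne (h3.symm.trans h4)

theorem exists_tour (T : Finset H) (hT : Subgroup.closure (T : Set H) = ⊤) (R : ℕ) :
    ∃ x : ℕ → H, (∀ n, wlen (T : Set H) (x n) ≤ R) ∧
      (∀ n, wlen (T : Set H) ((x n)⁻¹ * x (n + 1)) ≤ 3) ∧
      Set.InjOn x (Set.Iio ({h : H | wdist (T : Set H) 1 h ≤ R}.ncard)) := by
  classical
  choose p hp hp' using fun g : H => exists_parent hT g
  obtain ⟨l, n1, c1, h1, -, m1⟩ := goodTour_tree T hT p hp hp' R 1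
  have hne : 0 < l.length := by
    rcases l with _ | _
    · simp at h1
    · simp
  have hlev : ∀ x j, wlen (T : Set H) (p^[j] x) = wlen (T : Set H) x - j := by
    intro x j
    induction j with
    | zero => simp
    | succ j ihj => rw [Function.iterate_succ_apply', hp, ihj]; omega
  have hm : ∀ x, x ∈ l ↔ wlen (T : Set H) x ≤ R := by
    intro x
    rw [m1]
    simp only [wlen_one, Set.mem_ofPred_eq, zero_le, true_and, zero_add, Nat.sub_zero,
      and_iff_left_iff_imp]
    intro _
    apply wlen_eq_zero hT
    rw [hlev]; omega
  have hcard : {h : H | wdist (T : Set H) 1 h ≤ R}.ncard = l.length := by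
    have : {h : H | wdist (T : Set H) 1 h ≤ R} = (l.toFinset : Set H) := by
      ext x
      simp [hm, wdist]
    rw [this, Set.ncard_coe_finset, List.toFinset_card_of_nodup n1]
  rw [hcard]
  refine ⟨fun n => l[min n (l.length - 1)]'(by omega), ?_, ?_, ?_⟩
  · intro n
    rw [← hm]
    exact List.getElem_mem _
  · intro n
    by_cases h : n + 1 < l.length
    · have e1 : min n (l.length - 1) = n := by omega
      have e2 : min (n + 1) (l.length - 1) = n + 1 := by omega
      simp only [e1, e2]
      exact List.isChain_iff_getElem.1 c1 n h
    · have e1 : min n (l.length - 1) = l.length - 1 := by omega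
      have e2 : min (n + 1) (l.length - 1) = l.length - 1 := by omega
      simp only [e1, e2]
      simp [wlen_one]
  · intro a ha b hb hab
    simp only [Set.mem_Iio] at ha hb
    have e1 : min a (l.length - 1) = a := by omega
    have e2 : min b (l.length - 1) = b := by omega
    simp only [e1, e2] at hab
    exact (n1.getElem_inj_iff).1 hab

end Tour

section Wreath

variable {F H : Type*} [Group F] [Group H]

/-- The lamp configuration supported at `x` with value `b`. -/
noncomputable def lampSingle (x : H) (b : F) : ↥(lampN F H) :=
  ⟨by classical exact fun h => if h = x then b else 1, by
    classical
    apply Set.Finite.subset (Set.finite_singleton x)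
    intro h hh
    by_contra hne
    exact hh (if_neg hne)⟩

/-- The restriction of a lamp configuration to a set. -/
noncomputable def lampRestrict (D : Set H) (f : ↥(lampN F H)) : ↥(lampN F H) :=
  ⟨by classical exact fun h => if h ∈ D then (f : H → F) h else 1, by
    classical
    apply Set.Finite.subset (show {h : H | (f : H → F) h ≠ 1}.Finite from f.2)
    intro h hh
    by_contra hne
    apply hh
    have : (f : H → F) h = 1 := by simpa using hne
    simp [this]⟩

theorem lampRestrict_apply_mem {D : Set H} (f : ↥(lampN F H)) {h : H} (hh : h ∈ D) :
    (lampRestrict D f : H → F) h = (f : H → F) h := by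
  simp [lampRestrict, hh]

theorem lampRestrict_apply_not_mem {D : Set H} (f : ↥(lampN F H)) {h : H} (hh : h ∉ D) :
    (lampRestrict D f : H → F) h = 1 := by
  simp [lampRestrict, hh]

theorem lampRestrict_mul_compl (D : Set H) (f : ↥(lampN F H)) :
    lampRestrict D f * lampRestrict Dᶜ f = f := by
  apply Subtype.ext
  funext h
  show (lampRestrict D f : H → F) h * (lampRestrict Dᶜ f : H → F) h = (f : H → F) h
  by_cases hh : h ∈ D
  · rw [lampRestrict_apply_mem f hh, lampRestrict_apply_not_mem f (by simpa using hh), mul_one]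
  · rw [lampRestrict_apply_not_mem f hh, lampRestrict_apply_mem f (by simpa using hh), one_mul]

theorem eq_lampSingle (x : H) (f : ↥(lampN F H)) (hf : ∀ h, h ≠ x → (f : H → F) h = 1) :
    f = lampSingle x ((f : H → F) x) := by
  classical
  apply Subtype.ext
  funext h
  by_cases hh : h = x
  · subst hh; simp [lampSingle]
  · rw [hf h hh]; simp [lampSingle, hh]

theorem inl_lampSingle (x : H) (b : F) :
    (SemidirectProduct.inl (lampSingle x b) : Wr F H) =
      SemidirectProduct.inr x * SemidirectProduct.inl (lampSingle 1 b) *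
        (SemidirectProduct.inr x)⁻¹ := by
  classical
  rw [← map_inv, ← SemidirectProduct.inl_aut]
  congr 1
  apply Subtype.ext
  funext h
  show (lampSingle x b : H → F) h = ((lampSingle (1 : H) b : ↥(lampN F H)) : H → F) (x⁻¹ * h)
  by_cases hh : h = x
  · subst hh; simp [lampSingle]
  · have : x⁻¹ * h ≠ 1 := by
      intro hc
      exact hh (inv_mul_eq_one.1 hc).symm
    simp [lampSingle, hh, this]

/-- The number of lamps lit in an element of the wreath product. -/
noncomputable def lampCard (g : Wr F H) : ℕ := {h : H | (g.left : H → F) h ≠ 1}.ncard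

theorem lampCard_mul (g g' : Wr F H) : lampCard (g * g') ≤ lampCard g + lampCard g' := by
  have h1 : {h : H | (g.left : H → F) h ≠ 1}.Finite := g.left.2
  have h2 : {h : H | (g'.left : H → F) h ≠ 1}.Finite := g'.left.2
  have hsub : {h : H | ((g * g').left : H → F) h ≠ 1} ⊆ {h : H | (g.left : H → F) h ≠ 1} ∪
      (fun h => g.right * h) '' {h : H | (g'.left : H → F) h ≠ 1} := by
    intro h hh
    by_contra hc
    rw [Set.mem_union, not_or] at hc
    obtain ⟨ha, hb⟩ := hc
    apply hh
    show (g.left : H → F) h * (g'.left : H → F) (g.right⁻¹ * h) = 1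
    have ha' : (g.left : H → F) h = 1 := by simpa using ha
    have hb' : (g'.left : H → F) (g.right⁻¹ * h) = 1 := by
      by_contra hne
      exact hb ⟨g.right⁻¹ * h, hne, by simp⟩
    rw [ha', hb', one_mul]
  calc lampCard (g * g') ≤ _ := Set.ncard_le_ncard hsub (h1.union (h2.image _))
    _ ≤ _ := Set.ncard_union_le _ _
    _ ≤ _ := Nat.add_le_add_left (Set.ncard_image_le h2) _

theorem exists_lampCard_bound (S : Finset (Wr F H)) (hS : Subgroup.closure (S : Set (Wr F H)) = ⊤) :
    ∃ M : ℕ, ∀ g, lampCard g ≤ M * wlen (S : Set (Wr F H)) g := by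
  refine ⟨∑ s ∈ S, (lampCard s + lampCard s⁻¹), fun g => ?_⟩
  obtain ⟨l, h1, h2, h3⟩ := wlen_spec hS g
  rw [← h1, ← h3]
  clear h1 h3
  induction l with
  | nil => simp [lampCard]
  | cons x l ih =>
    have h4 := ih (fun y hy => h2 y (by simp [hy]))
    have h5 : lampCard x ≤ ∑ s ∈ S, (lampCard s + lampCard s⁻¹) := by
      rcases h2 x (by simp) with h | h
      · have := Finset.single_le_sum (f := fun s => lampCard s + lampCard s⁻¹)
          (fun _ _ => Nat.zero_le _) h
        omega
      · have := Finset.single_le_sum (f := fun s => lampCard s + lampCard s⁻¹)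
          (fun _ _ => Nat.zero_le _) h
        simp only [inv_inv] at this
        omega
    have := lampCard_mul x l.prod
    rw [List.prod_cons, List.length_cons, mul_add]
    omega

/-- Every configuration supported in `D` costs at most `c`. -/
def CostLe (S : Set (Wr F H)) (D : Set H) (c : ℕ) : Prop :=
  ∀ f : ↥(lampN F H), (∀ h, h ∉ D → (f : H → F) h = 1) →
    wlen S (SemidirectProduct.inl f : Wr F H) ≤ c

theorem costLe_union {S : Set (Wr F H)} (hS : Subgroup.closure S = ⊤) {D E : Set H} {c d : ℕ}
    (hD : CostLe S D c) (hE : CostLe S E d) : CostLe S (D ∪ E) (c + d) := by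
  intro f hf
  rw [← lampRestrict_mul_compl D f, map_mul]
  refine (wlen_mul hS _ _).trans (Nat.add_le_add (hD _ ?_) (hE _ ?_))
  · intro h hh
    exact lampRestrict_apply_not_mem f hh
  · intro h hh
    by_cases hd : h ∈ D
    · exact lampRestrict_apply_not_mem f (by simpa using hd)
    · rw [lampRestrict_apply_mem f (by simpa using hd)]
      exact hf h (by simp [hd, hh])

theorem costLe_biUnion {S : Set (Wr F H)} (hS : Subgroup.closure S = ⊤) {ι : Type*}
    (s : Finset ι) (D : ι → Set H) (c : ι → ℕ) (hD : ∀ i, CostLe S (D i) (c i)) :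
    CostLe S (⋃ i ∈ s, D i) (∑ i ∈ s, c i) := by
  classical
  induction s using Finset.induction_on with
  | empty =>
    intro f hf
    have : f = 1 := by
      apply Subtype.ext
      funext h
      exact hf h (by simp)
    simp [this, wlen_one]
  | insert i s hi ih =>
    rw [Finset.set_biUnion_insert, Finset.sum_insert hi]
    exact costLe_union hS (hD i) ih

theorem tour_cost {S : Set (Wr F H)} (hS : Subgroup.closure S = ⊤) {T : Set H} (K K' : ℕ)
    (hK : ∀ h, wlen S (SemidirectProduct.inr h : Wr F H) ≤ K * wlen T h)
    (hK' : ∀ b : F, wlen S (SemidirectProduct.inl (lampSingle (1 : H) b) : Wr F H) ≤ K')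
    (x : ℕ → H) (hx : ∀ n, wlen T ((x n)⁻¹ * x (n + 1)) ≤ 3) (p n : ℕ) (f : ↥(lampN F H))
    (hf : ∀ h, (∀ j < n, h ≠ x (p + j)) → (f : H → F) h = 1) :
    wlen S ((SemidirectProduct.inr (x p))⁻¹ * SemidirectProduct.inl f *
      SemidirectProduct.inr (x (p + n)) : Wr F H) ≤ n * (K' + 3 * K) := by
  induction n generalizing f with
  | zero =>
    have : f = 1 := by
      apply Subtype.ext
      funext h
      exact hf h (by simp)
    simp [this, wlen_one]
  | succ n ih =>
    set D : Set H := {h | h ≠ x (p + n)} with hDdef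
    have h1 := ih (lampRestrict D f) (by
      intro h hh
      by_cases hd : h ∈ D
      · rw [lampRestrict_apply_mem f hd]
        apply hf
        intro j hj
        rcases Nat.lt_succ_iff_lt_or_eq.1 hj with hj | rfl
        · exact hh j hj
        · exact hd
      · exact lampRestrict_apply_not_mem f hd)
    have h2 := eq_lampSingle (x (p + n)) (lampRestrict Dᶜ f) (by
      intro h hh
      exact lampRestrict_apply_not_mem f (by simpa [hDdef] using hh))
    generalize ((lampRestrict Dᶜ f : ↥(lampN F H)) : H → F) (x (p + n)) = b at h2
    have h3 : wlen S (SemidirectProduct.inr ((x (p + n))⁻¹ * x (p + (n + 1))) : Wr F H) ≤ 3 * K := by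
      refine (hK _).trans ?_
      rw [mul_comm]
      exact Nat.mul_le_mul_right _ (hx (p + n))
    have h4 := hK' b
    have e : ((SemidirectProduct.inr (x p))⁻¹ * SemidirectProduct.inl f *
      SemidirectProduct.inr (x (p + (n + 1))) : Wr F H) =
      ((SemidirectProduct.inr (x p))⁻¹ * SemidirectProduct.inl (lampRestrict D f) *
      SemidirectProduct.inr (x (p + n))) * SemidirectProduct.inl (lampSingle (1 : H) b) *
      SemidirectProduct.inr ((x (p + n))⁻¹ * x (p + (n + 1))) := by
      conv_lhs => rw [← lampRestrict_mul_compl D f, h2, map_mul, inl_lampSingle]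
      rw [map_mul, map_inv]
      simp only [mul_assoc]
    rw [e]
    refine (wlen_mul hS _ _).trans ((Nat.add_le_add_right (wlen_mul hS _ _) _).trans ?_)
    rw [add_mul, one_mul]
    omega

theorem costLe_interval {S : Set (Wr F H)} (hS : Subgroup.closure S = ⊤) {T : Set H} (K K' R : ℕ)
    (hK : ∀ h, wlen S (SemidirectProduct.inr h : Wr F H) ≤ K * wlen T h)
    (hK' : ∀ b : F, wlen S (SemidirectProduct.inl (lampSingle (1 : H) b) : Wr F H) ≤ K')
    (x : ℕ → H) (hR : ∀ n, wlen T (x n) ≤ R)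
    (hx : ∀ n, wlen T ((x n)⁻¹ * x (n + 1)) ≤ 3) (p n : ℕ) :
    CostLe S {h | ∃ j < n, h = x (p + j)} (2 * (K * R) + n * (K' + 3 * K)) := by
  intro f hf
  have h1 := tour_cost hS K K' hK hK' x hx p n f (by
    intro h hh
    apply hf
    rintro ⟨j, hj, rfl⟩
    exact hh j hj rfl)
  have h2 : ∀ n, wlen S (SemidirectProduct.inr (x n) : Wr F H) ≤ K * R :=
    fun n => (hK _).trans (Nat.mul_le_mul_left _ (hR n))
  have e : (SemidirectProduct.inl f : Wr F H) = SemidirectProduct.inr (x p) *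
    ((SemidirectProduct.inr (x p))⁻¹ * SemidirectProduct.inl f *
      SemidirectProduct.inr (x (p + n))) * (SemidirectProduct.inr (x (p + n)))⁻¹ := by group
  rw [e]
  refine (wlen_mul hS _ _).trans ((Nat.add_le_add_right (wlen_mul hS _ _) _).trans ?_)
  rw [wlen_inv hS]
  have := h2 p
  have := h2 (p + n)
  omega

/-- The configuration with value `a` exactly at the points `x (i * N + j)`, `j < n i`. -/
noncomputable def cubeConf {k : ℕ} (a : F) (x : ℕ → H) (N : ℕ) (n : Fin k → ℕ) : ↥(lampN F H) :=
  ⟨by classical exact fun h => if ∃ i, ∃ j < n i, h = x (i * N + j) then a else 1, by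
    classical
    have hfin : (⋃ i : Fin k, (fun j => x (i * N + j)) '' Set.Iio (n i)).Finite :=
      Set.finite_iUnion fun i => (Set.finite_Iio _).image _
    apply hfin.subset
    intro h hh
    by_contra hne
    apply hh
    refine if_neg ?_
    rintro ⟨i, j, hj, rfl⟩
    exact hne (Set.mem_iUnion.2 ⟨i, j, hj, rfl⟩)⟩

theorem cubeConf_pos {k : ℕ} (a : F) (x : ℕ → H) (N : ℕ) (n : Fin k → ℕ) (h : H)
    (hh : ∃ i, ∃ j < n i, h = x (i * N + j)) : (cubeConf a x N n : H → F) h = a := by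
  simp only [cubeConf]; rw [if_pos hh]

theorem cubeConf_neg {k : ℕ} (a : F) (x : ℕ → H) (N : ℕ) (n : Fin k → ℕ) (h : H)
    (hh : ¬ ∃ i, ∃ j < n i, h = x (i * N + j)) : (cubeConf a x N n : H → F) h = 1 := by
  simp only [cubeConf]; rw [if_neg hh]

theorem cubeConf_upper {S : Set (Wr F H)} (hS : Subgroup.closure S = ⊤) {T : Set H} (K K' R : ℕ)
    (hK : ∀ h, wlen S (SemidirectProduct.inr h : Wr F H) ≤ K * wlen T h)
    (hK' : ∀ b : F, wlen S (SemidirectProduct.inl (lampSingle (1 : H) b) : Wr F H) ≤ K')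
    (x : ℕ → H) (hR : ∀ n, wlen T (x n) ≤ R)
    (hx : ∀ n, wlen T ((x n)⁻¹ * x (n + 1)) ≤ 3) (a : F) (N : ℕ) {k : ℕ} (n n' : Fin k → ℕ) :
    wlen S (SemidirectProduct.inl ((cubeConf a x N n)⁻¹ * cubeConf a x N n') : Wr F H) ≤
      ∑ i, (2 * (K * R) + (max (n i) (n' i) - min (n i) (n' i)) * (K' + 3 * K)) := by
  refine costLe_biUnion hS Finset.univ
    (fun i : Fin k => {h | ∃ j < max (n i) (n' i) - min (n i) (n' i),
      h = x ((i * N + min (n i) (n' i)) + j)}) _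
    (fun i => costLe_interval hS K K' R hK hK' x hR hx _ _) _ ?_
  intro h hh
  have hh' : ∀ i : Fin k, ∀ j < max (n i) (n' i) - min (n i) (n' i),
      h ≠ x ((i * N + min (n i) (n' i)) + j) := by
    intro i j hj he
    apply hh
    simp only [Finset.mem_univ, Set.iUnion_true, Set.mem_iUnion]
    exact ⟨i, j, hj, he⟩
  show ((cubeConf a x N n : H → F) h)⁻¹ * (cubeConf a x N n' : H → F) h = 1
  have hiff : (∃ i : Fin k, ∃ j < n i, h = x (i * N + j)) ↔
      (∃ i : Fin k, ∃ j < n' i, h = x (i * N + j)) := by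
    constructor
    · rintro ⟨i, j, hj, he⟩
      refine ⟨i, j, ?_, he⟩
      by_contra hc
      refine hh' i (j - min (n i) (n' i)) (by omega) ?_
      rw [he]; congr 1; omega
    · rintro ⟨i, j, hj, he⟩
      refine ⟨i, j, ?_, he⟩
      by_contra hc
      refine hh' i (j - min (n i) (n' i)) (by omega) ?_
      rw [he]; congr 1; omega
  by_cases hc : ∃ i : Fin k, ∃ j < n i, h = x (i * N + j)
  · rw [cubeConf_pos a x N n h hc, cubeConf_pos a x N n' h (hiff.1 hc), inv_mul_cancel]
  · rw [cubeConf_neg a x N n h hc, cubeConf_neg a x N n' h (fun h' => hc (hiff.2 h')),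
      inv_mul_cancel]

theorem cubeConf_lower {a : F} (ha : a ≠ 1) (x : ℕ → H) (N : ℕ) {k : ℕ}
    (hinj : Set.InjOn x (Set.Iio (k * N))) (n n' : Fin k → ℕ) (hn : ∀ i, n i ≤ N)
    (hn' : ∀ i, n' i ≤ N) (i : Fin k) :
    max (n i) (n' i) - min (n i) (n' i) ≤
      lampCard (SemidirectProduct.inl ((cubeConf a x N n)⁻¹ * cubeConf a x N n') : Wr F H) := by
  have hlt : ∀ (i : Fin k) (j : ℕ), j < N → (i : ℕ) * N + j < k * N := by
    intro i j hj
    have h1 : ((i : ℕ) + 1) * N ≤ k * N := Nat.mul_le_mul_right _ i.2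
    rw [add_mul, one_mul] at h1
    omega
  have huniq : ∀ (i i' : Fin k) (j j' : ℕ), j < N → j' < N →
      x ((i : ℕ) * N + j) = x ((i' : ℕ) * N + j') → i = i' ∧ j = j' := by
    intro i i' j j' hj hj' he
    have e := hinj (hlt i j hj) (hlt i' j' hj') he
    have hN : 0 < N := by omega
    have e1 : (i : ℕ) = i' := by
      have := congrArg (· / N) e
      simp only [mul_comm _ N, Nat.mul_add_div hN, Nat.div_eq_of_lt hj, Nat.div_eq_of_lt hj'] at this
      omega
    refine ⟨Fin.ext e1, ?_⟩
    rw [e1] at e; omega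
  have hcard : ((fun j => x ((i : ℕ) * N + j)) ''
      Set.Ico (min (n i) (n' i)) (max (n i) (n' i))).ncard =
      max (n i) (n' i) - min (n i) (n' i) := by
    rw [Set.InjOn.ncard_image]
    · rw [← Finset.coe_Ico, Set.ncard_coe_finset, Nat.card_Ico]
    · intro j hj j' hj' he
      have := hn i
      have := hn' i
      exact (huniq i i j j' (by have := hj.2; omega) (by have := hj'.2; omega) he).2
  rw [← hcard]
  refine Set.ncard_le_ncard ?_ ((cubeConf a x N n)⁻¹ * cubeConf a x N n').2
  rintro _ ⟨j, hj, rfl⟩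
  have b1 := hn i
  have b2 := hn' i
  have b3 := hj.1
  have b4 := hj.2
  have key : ∀ m : Fin k → ℕ, (∀ i, m i ≤ N) →
      ((∃ i', ∃ j' < m i', x ((i : ℕ) * N + j) = x ((i' : Fin k) * N + j')) ↔ j < m i) := by
    intro m hm
    constructor
    · rintro ⟨i', j', hj', he⟩
      have := hm i'
      obtain ⟨rfl, rfl⟩ := huniq i i' j j' (by omega) (by omega) he
      exact hj'
    · intro h
      exact ⟨i, j, h, rfl⟩
  show ((cubeConf a x N n : H → F) (x (i * N + j)))⁻¹ *
    (cubeConf a x N n' : H → F) (x (i * N + j)) ≠ 1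
  rcases le_total (n i) (n' i) with h | h
  · rw [cubeConf_neg a x N n _ (by rw [key n hn]; omega),
      cubeConf_pos a x N n' _ (by rw [key n' hn']; omega)]
    simpa using ha
  · rw [cubeConf_pos a x N n _ (by rw [key n hn]; omega),
      cubeConf_neg a x N n' _ (by rw [key n' hn']; omega)]
    simpa using ha

end Wreath

theorem exists_radius (b : ℕ → ℕ)
    (hgrowth : Filter.Tendsto (fun R : ℕ => (b R : ℝ) / (R : ℝ)) Filter.atTop Filter.atTop)
    (lam : ℕ → ℕ) (hlam : Filter.Tendsto lam Filter.atTop Filter.atTop) (k : ℕ) :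
    ∃ R : ℕ → ℕ, (∀ m, k * lam m ≤ b (R m)) ∧
      ∀ ε : ℝ, 0 < ε → ∀ᶠ m in Filter.atTop, (R m : ℝ) ≤ ε * (lam m : ℝ) := by
  have hlin : ∀ c : ℕ, ∀ᶠ R in Filter.atTop, c * R ≤ b R := by
    intro c
    filter_upwards [hgrowth.eventually_ge_atTop (c : ℝ), Filter.eventually_gt_atTop 0] with R h1 h2
    have h3 : (0 : ℝ) < R := by exact_mod_cast h2
    rw [le_div_iff₀ h3] at h1
    exact_mod_cast h1
  have hne : ∀ m, ∃ R, k * lam m ≤ b R := by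
    intro m
    obtain ⟨R, h1, h2⟩ := ((hlin (k * lam m)).and (Filter.eventually_ge_atTop 1)).exists
    exact ⟨R, le_trans (Nat.le_mul_of_pos_right _ h2) h1⟩
  refine ⟨fun m => sInf {R | k * lam m ≤ b R}, fun m => Nat.sInf_mem (hne m), ?_⟩
  intro ε hε
  obtain ⟨q, hq⟩ := exists_nat_gt (1 / ε)
  have hq0 : 0 < q := by
    have : (0 : ℝ) < q := lt_trans (by positivity) hq
    exact_mod_cast this
  have hdiv : Filter.Tendsto (fun m => lam m / q) Filter.atTop Filter.atTop :=
    (Nat.tendsto_div_const_atTop hq0.ne').comp hlam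
  filter_upwards [hdiv.eventually (hlin (2 * q * k)), hdiv.eventually_ge_atTop 1] with m h1 h2
  have h3 : lam m < q * (lam m / q + 1) := Nat.lt_mul_div_succ _ hq0
  have h4 : lam m ≤ 2 * q * (lam m / q) := by nlinarith
  have h5 : k * lam m ≤ b (lam m / q) := by
    refine le_trans (Nat.mul_le_mul_left k h4) (le_trans (le_of_eq ?_) h1)
    ring
  have h6 : sInf {R | k * lam m ≤ b R} ≤ lam m / q := Nat.sInf_le h5
  have h7 : q * sInf {R | k * lam m ≤ b R} ≤ lam m :=
    le_trans (Nat.mul_le_mul_left q h6) (Nat.mul_div_le _ _)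
  have h8 : (q : ℝ) * (sInf {R | k * lam m ≤ b R} : ℕ) ≤ lam m := by exact_mod_cast h7
  have h9 : 1 ≤ ε * q := by
    rw [div_lt_iff₀ hε] at hq
    linarith
  have h10 : (0 : ℝ) ≤ (sInf {R | k * lam m ≤ b R} : ℕ) := Nat.cast_nonneg _
  nlinarith

theorem floor_diff (u v l : ℝ) (hu : 0 ≤ u) (hv : 0 ≤ v) (hl : 0 ≤ l) :
    |u - v| * l - 1 ≤ ((max ⌊u * l⌋₊ ⌊v * l⌋₊ - min ⌊u * l⌋₊ ⌊v * l⌋₊ : ℕ) : ℝ) ∧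
    ((max ⌊u * l⌋₊ ⌊v * l⌋₊ - min ⌊u * l⌋₊ ⌊v * l⌋₊ : ℕ) : ℝ) ≤ |u - v| * l + 1 := by
  have a1 := Nat.floor_le (mul_nonneg hu hl)
  have a2 := Nat.lt_floor_add_one (u * l)
  have b1 := Nat.floor_le (mul_nonneg hv hl)
  have b2 := Nat.lt_floor_add_one (v * l)
  have hc : ((max ⌊u * l⌋₊ ⌊v * l⌋₊ - min ⌊u * l⌋₊ ⌊v * l⌋₊ : ℕ) : ℝ) =
      |(⌊u * l⌋₊ : ℝ) - ⌊v * l⌋₊| := by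
    rw [Nat.cast_sub min_le_max, Nat.cast_max, Nat.cast_min, max_sub_min_eq_abs]
    exact abs_sub_comm _ _
  have he : |u - v| * l = |u * l - v * l| := by
    rw [← sub_mul, abs_mul, abs_of_nonneg hl]
  rw [hc, he]
  generalize (⌊u * l⌋₊ : ℝ) = p at *
  generalize (⌊v * l⌋₊ : ℝ) = q at *
  constructor
  · have : |u * l - v * l| ≤ |p - q| + 1 := by
      rw [abs_le]
      have := neg_abs_le (p - q)
      have := le_abs_self (p - q)
      constructor <;> linarith
    linarith
  · rw [abs_le]
    have := neg_abs_le (u * l - v * l)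
    have := le_abs_self (u * l - v * l)
    constructor <;> linarith

/-- Let `F` be a nontrivial finite group and `H` a finitely generated infinite group of
super-linear growth. Then for every `k ≥ 1` and every asymptotic cone of `F ≀ H` (given
by a nonprincipal ultrafilter `ω`, basepoints `o` and scaling factors `lam → ∞`), there
is a biLipschitz embedding of the cube `[0,1]^k` into the cone: a family `Ψ` of cone
points (rescaled distance to the basepoints bounded) whose pairwise rescaled distances
converge, along `ω`, to the distance in the cube up to a fixed biLipschitz constant `L`.
Consequently the asymptotic cones of `F ≀ H` have infinite topological dimension. -/
theorem stmt13 (F H : Type*) [Group F] [Group H] [Nontrivial F] [Finite F] [Infinite H]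
    (T : Finset H) (hT : Subgroup.closure (T : Set H) = ⊤)
    (hgrowth : Filter.Tendsto
      (fun R : ℕ => ({h : H | wdist (T : Set H) 1 h ≤ R}.ncard : ℝ) / (R : ℝ))
      Filter.atTop Filter.atTop)
    (S : Finset (Wr F H)) (hS : Subgroup.closure (S : Set (Wr F H)) = ⊤)
    (ω : Ultrafilter ℕ) (hfree : (ω : Filter ℕ) ≤ Filter.atTop)
    (o : ℕ → Wr F H) (lam : ℕ → ℕ)
    (hlam : Filter.Tendsto lam Filter.atTop Filter.atTop)
    (k : ℕ) (hk : 1 ≤ k) :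
    ∃ (Ψ : (Fin k → ℝ) → ℕ → Wr F H) (L : ℝ), 1 ≤ L ∧
      (∃ C : ℝ, ∀ r : Fin k → ℝ, (∀ i, r i ∈ Set.Icc (0 : ℝ) 1) →
        ∀ᶠ m in (ω : Filter ℕ),
          (wdist (S : Set (Wr F H)) (o m) (Ψ r m) : ℝ) ≤ C * (lam m : ℝ)) ∧
      ∀ r s : Fin k → ℝ, (∀ i, r i ∈ Set.Icc (0 : ℝ) 1) →
        (∀ i, s i ∈ Set.Icc (0 : ℝ) 1) → ∀ ε : ℝ, 0 < ε →
          ∀ᶠ m in (ω : Filter ℕ),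
            dist r s / L - ε ≤ (wdist (S : Set (Wr F H)) (Ψ r m) (Ψ s m) : ℝ) / (lam m : ℝ) ∧
            (wdist (S : Set (Wr F H)) (Ψ r m) (Ψ s m) : ℝ) / (lam m : ℝ) ≤ L * dist r s + ε := by
  classical
  obtain ⟨a, ha⟩ := exists_ne (1 : F)
  obtain ⟨M, hM⟩ := exists_lampCard_bound S hS
  obtain ⟨R, hR1, hR2⟩ := exists_radius _ hgrowth lam hlam k
  obtain ⟨K, hK⟩ : ∃ K : ℕ, ∀ h : H, wlen (S : Set (Wr F H)) (SemidirectProduct.inr h : Wr F H) ≤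
      K * wlen (T : Set H) h := by
    refine ⟨∑ t ∈ T, wlen (S : Set (Wr F H)) (SemidirectProduct.inr t : Wr F H), fun h => ?_⟩
    refine wlen_bilip hT hS (SemidirectProduct.inr : H →* Wr F H) _ ?_ h
    intro t ht
    exact Finset.single_le_sum
      (f := fun t => wlen (S : Set (Wr F H)) (SemidirectProduct.inr t : Wr F H))
      (fun _ _ => Nat.zero_le _) ht
  obtain ⟨K', hK'⟩ : ∃ K' : ℕ, ∀ b : F, wlen (S : Set (Wr F H))
      (SemidirectProduct.inl (lampSingle (1 : H) b) : Wr F H) ≤ K' := by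
    obtain ⟨K', h⟩ := (Set.finite_range fun b : F => wlen (S : Set (Wr F H))
      (SemidirectProduct.inl (lampSingle (1 : H) b) : Wr F H)).bddAbove
    exact ⟨K', fun b => h ⟨b, rfl⟩⟩
  choose x hx1 hx2 hx3 using fun m => exists_tour T hT (R m)
  set Ψ : (Fin k → ℝ) → ℕ → Wr F H := fun r m =>
    o m * SemidirectProduct.inl (cubeConf a (x m) (lam m) (fun i => ⌊r i * lam m⌋₊)) with hΨ
  have hdist : ∀ r s m, wdist (S : Set (Wr F H)) (Ψ r m) (Ψ s m) =
      wlen (S : Set (Wr F H)) (SemidirectProduct.inl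
        ((cubeConf a (x m) (lam m) (fun i => ⌊r i * lam m⌋₊))⁻¹ *
          cubeConf a (x m) (lam m) (fun i => ⌊s i * lam m⌋₊)) : Wr F H) := by
    intro r s m
    simp only [hΨ, wdist, map_mul, map_inv]
    congr 1
    group
  set c : ℝ := (K' : ℝ) + 3 * K with hc
  have hc0 : 0 ≤ c := by positivity
  set L : ℝ := 1 + M + k * c with hL
  have hL1 : 1 ≤ L := by
    have : 0 ≤ k * c := by positivity
    have : (0 : ℝ) ≤ M := by positivity
    linarith
  have hLM : (M : ℝ) ≤ L := by
    have : 0 ≤ k * c := by positivity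
    linarith
  have hLc : k * c ≤ L := by
    have : (0 : ℝ) ≤ M := by positivity
    linarith
  have main : ∀ r s : Fin k → ℝ, (∀ i, r i ∈ Set.Icc (0 : ℝ) 1) →
        (∀ i, s i ∈ Set.Icc (0 : ℝ) 1) → ∀ ε : ℝ, 0 < ε →
          ∀ᶠ m in (ω : Filter ℕ),
            dist r s / L - ε ≤ (wdist (S : Set (Wr F H)) (Ψ r m) (Ψ s m) : ℝ) / (lam m : ℝ) ∧
            (wdist (S : Set (Wr F H)) (Ψ r m) (Ψ s m) : ℝ) / (lam m : ℝ) ≤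
              L * dist r s + ε := by
    intro r s hr hs ε hε
    have hq : (0 : ℝ) < ε / (2 * (k * 2 * K + 1)) := by positivity
    obtain ⟨N, hN⟩ := exists_nat_gt (1 / ε + 2 * (k * c) / ε)
    filter_upwards [hfree (hR2 _ hq), hfree (hlam.eventually_ge_atTop (N + 1))] with m h1 h2
    have hl0 : (0 : ℝ) < lam m := by
      have : 0 < lam m := by omega
      exact_mod_cast this
    have hlN : 1 / ε + 2 * (k * c) / ε ≤ lam m := by
      have : (N : ℝ) ≤ lam m := by
        have : N ≤ lam m := by omega
        exact_mod_cast this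
      linarith
    have hkc : 0 ≤ k * c := by positivity
    have e0 : 1 + 2 * (k * c) ≤ ε * lam m := by
      rw [← add_div, div_le_iff₀ hε] at hlN
      linarith
    have hfl := fun i => floor_diff (r i) (s i) (lam m) (hr i).1 (hs i).1 hl0.le
    have hle : ∀ (u : Fin k → ℝ), (∀ i, u i ∈ Set.Icc (0 : ℝ) 1) →
        ∀ i, ⌊u i * lam m⌋₊ ≤ lam m := by
      intro u hu i
      apply Nat.floor_le_of_le
      have := (hu i).2
      nlinarith
    have hD0 : (0 : ℝ) ≤ (wdist (S : Set (Wr F H)) (Ψ r m) (Ψ s m) : ℝ) := Nat.cast_nonneg _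
    constructor
    · have hlow : ∀ i, |r i - s i| * lam m - 1 ≤
          M * (wdist (S : Set (Wr F H)) (Ψ r m) (Ψ s m) : ℝ) := by
        intro i
        refine (hfl i).1.trans ?_
        have g1 := cubeConf_lower ha (x m) (lam m)
          ((hx3 m).mono (Set.Iio_subset_Iio (hR1 m))) (fun i => ⌊r i * lam m⌋₊)
          (fun i => ⌊s i * lam m⌋₊) (hle r hr) (hle s hs) i
        have g2 := g1.trans (hM _)
        rw [← hdist r s m] at g2
        exact_mod_cast g2
      have hd : dist r s ≤ (L * (wdist (S : Set (Wr F H)) (Ψ r m) (Ψ s m) : ℝ) + 1) / lam m := by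
        rw [dist_pi_le_iff (by positivity)]
        intro i
        rw [Real.dist_eq, le_div_iff₀ hl0]
        have := hlow i
        have := mul_le_mul_of_nonneg_right hLM hD0
        linarith
      rw [le_div_iff₀ hl0] at hd
      have hL0 : 0 < L := by linarith
      rw [sub_le_iff_le_add, div_le_iff₀ hL0, div_add' _ _ _ hl0.ne', div_mul_eq_mul_div,
        le_div_iff₀ hl0]
      nlinarith
    · have hup := cubeConf_upper hS K K' (R m) hK hK' (x m) (hx1 m) (hx2 m) a (lam m)
        (fun i => ⌊r i * lam m⌋₊) (fun i => ⌊s i * lam m⌋₊)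
      rw [← hdist r s m] at hup
      have hup' : (wdist (S : Set (Wr F H)) (Ψ r m) (Ψ s m) : ℝ) ≤
          ∑ i : Fin k, (2 * (K * R m : ℝ) + (dist r s * lam m + 1) * c) := by
        refine le_trans (Nat.cast_le.2 hup) ?_
        simp only [Nat.cast_sum]
        refine Finset.sum_le_sum fun i _ => ?_
        rw [Nat.cast_add, Nat.cast_mul, Nat.cast_mul, Nat.cast_mul, Nat.cast_add, Nat.cast_mul]
        simp only [Nat.cast_ofNat]
        refine add_le_add le_rfl (mul_le_mul_of_nonneg_right ((hfl i).2.trans ?_) hc0)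
        have := dist_le_pi_dist r s i
        rw [Real.dist_eq] at this
        nlinarith
      rw [Finset.sum_const, Finset.card_univ, Fintype.card_fin, nsmul_eq_mul] at hup'
      rw [div_le_iff₀ hl0]
      have hd0 : 0 ≤ dist r s * lam m := by positivity
      have t1 : k * 2 * K * (R m : ℝ) ≤ ε / 2 * lam m := by
        have hp : (0 : ℝ) ≤ k * 2 * K := by positivity
        calc k * 2 * K * (R m : ℝ) ≤ (k * 2 * K + 1) * (R m : ℝ) := by
              have : (0 : ℝ) ≤ R m := by positivity
              nlinarith
          _ ≤ (k * 2 * K + 1) * (ε / (2 * (k * 2 * K + 1)) * lam m) :=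
              mul_le_mul_of_nonneg_left h1 (by positivity)
          _ = ε / 2 * lam m := by field_simp
      have t2 := mul_le_mul_of_nonneg_right hLc hd0
      nlinarith
  refine ⟨Ψ, L, hL1, ⟨L + 1, ?_⟩, main⟩
  intro r hr
  filter_upwards [main 0 r (fun i => by simp) hr 1 one_pos,
    hfree (hlam.eventually_ge_atTop 1)] with m h1 h2
  have hl0 : (0 : ℝ) < lam m := by exact_mod_cast h2
  have h0 : Ψ 0 m = o m := by
    have : cubeConf a (x m) (lam m) (fun i : Fin k => ⌊(0 : Fin k → ℝ) i * lam m⌋₊) = 1 := by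
      apply Subtype.ext
      funext h
      exact cubeConf_neg _ _ _ _ _ (by simp)
    simp only [hΨ, this, map_one, mul_one]
  have h3 := h1.2
  rw [h0, div_le_iff₀ hl0] at h3
  have hd : dist (0 : Fin k → ℝ) r ≤ 1 := by
    rw [dist_pi_le_iff zero_le_one]
    intro i
    rw [Real.dist_eq, abs_le]
    have := (hr i).1
    have := (hr i).2
    constructor <;> simp <;> linarith
  refine h3.trans (mul_le_mul_of_nonneg_right ?_ hl0.le)
  nlinarith
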